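/- (Theorem 2(ii), fluid model) Suppose (λ_a+λ_b)/(2μ_b) < T < (λ_a+2λ_b)/(2μ_b). Set β := (2μ_b/λ_b)((λ_a+2λ_b)/(2μ_b) − T) and t_b := (λ_a + λ_b β)/(2μ_b). Define F_a ≡ 1 on [0,T], and F_b(t) = β for t ∈ [0,t_b], F_b(t) = β + (μ_b/λ_b)(t − t_b) for t ∈ [t_b,T]. Then: 0 < β < 1; 0 < t_b < T; F_b(T) = 1; and with q_0 = (λ_a + λ_b β)/2 one has q_b(t) = q_0 for all t ∈ [t_b,T], q_b(t) ≥ q_0 for all t ∈ (0,t_b], and q_a(t) > q_0 for all t ∈ (0,T]. Consequently (F_a,F_b) is a Nash equilibrium of the fluid arrival game. -/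

import Mathlib

/-- Extension of a cdf `F` defined on `[0,T]` to all of `ℝ`. -/
noncomputable def Fext (T : ℝ) (F : ℝ → ℝ) (t : ℝ) : ℝ :=
  if t < 0 then 0 else if t ≤ T then F t else F T

/-- Support of the Borel measure on `[0,T]` induced by the cdf `F`:
points every neighbourhood of which carries positive mass. -/
def fluidSupport (T : ℝ) (F : ℝ → ℝ) : Set ℝ :=
  {t | t ∈ Set.Icc 0 T ∧ ∀ ε > 0, Fext T F (t - ε) < Fext T F (t + ε)}

/-- Queue (cost) faced by a belief-`mu` customer arriving at time `t`:
`q_0 = (λ_a F_a(0) + λ_b F_b(0))/2` at the opening, and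
`q(t) = λ_a F_a(t) + λ_b F_b(t) - μ t` for `t > 0`. -/
noncomputable def cost (la lb mu : ℝ) (Fa Fb : ℝ → ℝ) (t : ℝ) : ℝ :=
  if t = 0 then (la * Fa 0 + lb * Fb 0) / 2
  else la * Fa t + lb * Fb t - mu * t

/-- Nash equilibrium of the fluid arrival game: on the support of its own arrival
distribution each type's queue is minimal over all times in `[0,T]`. -/
def IsFluidNash (la lb mua mub T : ℝ) (Fa Fb : ℝ → ℝ) : Prop :=
  (∀ t ∈ fluidSupport T Fa, ∀ s ∈ Set.Icc 0 T,
    cost la lb mua Fa Fb t ≤ cost la lb mua Fa Fb s) ∧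
  (∀ t ∈ fluidSupport T Fb, ∀ s ∈ Set.Icc 0 T,
    cost la lb mub Fa Fb t ≤ cost la lb mub Fa Fb s)


/-- Theorem 2(ii) of the fluid model: for `(λ_a+λ_b)/(2μ_b) < T < (λ_a+2λ_b)/(2μ_b)`,
all type-`a` customers arrive at `0`, type-`b` customers place mass `β` at `0` and
arrive with density `μ_b/λ_b` on `[t_b,T]`; this is a Nash equilibrium. -/
theorem fluid_equilibrium_case_ii
    (la lb mua mub T beta tb : ℝ)
    (hla : 0 < la) (hlb : 0 < lb) (hmua : 0 < mua) (hmu : mua < mub)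
    (hT1 : (la + lb) / (2 * mub) < T) (hT2 : T < (la + 2 * lb) / (2 * mub))
    (hbeta : beta = (2 * mub / lb) * ((la + 2 * lb) / (2 * mub) - T))
    (htb : tb = (la + lb * beta) / (2 * mub))
    (Fa Fb : ℝ → ℝ)
    (hFa : ∀ t ∈ Set.Icc (0:ℝ) T, Fa t = 1)
    (hFb1 : ∀ t ∈ Set.Icc (0:ℝ) T, t ≤ tb → Fb t = beta)
    (hFb2 : ∀ t ∈ Set.Icc (0:ℝ) T, tb ≤ t → Fb t = beta + (mub / lb) * (t - tb)) :
    0 < beta ∧ beta < 1 ∧ 0 < tb ∧ tb < T ∧ Fb T = 1 ∧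
    (la * Fa 0 + lb * Fb 0) / 2 = (la + lb * beta) / 2 ∧
    (∀ t ∈ Set.Icc tb T,
      la * Fa t + lb * Fb t - mub * t = (la + lb * beta) / 2) ∧
    (∀ t ∈ Set.Ioc (0:ℝ) tb,
      (la + lb * beta) / 2 ≤ la * Fa t + lb * Fb t - mub * t) ∧
    (∀ t ∈ Set.Ioc (0:ℝ) T,
      (la + lb * beta) / 2 < la * Fa t + lb * Fb t - mua * t) ∧
    IsFluidNash la lb mua mub T Fa Fb := by
  have hmub : 0 < mub := hmua.trans hmu
  rw [div_lt_iff₀ (by positivity)] at hT1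
  rw [lt_div_iff₀ (by positivity)] at hT2
  have hb : lb * beta = la + 2 * lb - 2 * mub * T := by
    rw [hbeta]; field_simp
  have ht : 2 * (mub * tb) = la + lb * beta := by
    rw [htb]; field_simp
  have b0 : 0 < beta := by
    by_contra h
    nlinarith [mul_le_mul_of_nonneg_left (not_lt.mp h) hlb.le]
  have b1 : beta < 1 := by
    by_contra h
    nlinarith [mul_le_mul_of_nonneg_left (not_lt.mp h) hlb.le]
  have t0 : 0 < tb := by
    rw [htb]; positivity
  have t1 : tb < T := by
    by_contra h
    nlinarith [mul_le_mul_of_nonneg_left (not_lt.mp h) hmub.le]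
  have hT : 0 < T := t0.trans t1
  have hF2 : ∀ t ∈ Set.Icc (0:ℝ) T, tb ≤ t → lb * Fb t = lb * beta + mub * (t - tb) := by
    intro t h h'
    rw [hFb2 t h h']; field_simp
  have c0 : (la * Fa 0 + lb * Fb 0) / 2 = (la + lb * beta) / 2 := by
    rw [hFa 0 ⟨le_rfl, hT.le⟩, hFb1 0 ⟨le_rfl, hT.le⟩ t0.le, mul_one]
  have c1 : ∀ t ∈ Set.Icc tb T,
      la * Fa t + lb * Fb t - mub * t = (la + lb * beta) / 2 := by
    intro t h
    have h' : t ∈ Set.Icc (0:ℝ) T := ⟨t0.le.trans h.1, h.2⟩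
    rw [hFa t h', hF2 t h' h.1]
    linarith
  have c2 : ∀ t ∈ Set.Ioc (0:ℝ) tb,
      (la + lb * beta) / 2 ≤ la * Fa t + lb * Fb t - mub * t := by
    intro t h
    have h' : t ∈ Set.Icc (0:ℝ) T := ⟨h.1.le, h.2.trans t1.le⟩
    rw [hFa t h', hFb1 t h' h.2]
    nlinarith [mul_le_mul_of_nonneg_left h.2 hmub.le]
  have c2' : ∀ t ∈ Set.Ioc (0:ℝ) T,
      (la + lb * beta) / 2 ≤ la * Fa t + lb * Fb t - mub * t := by
    intro t h
    rcases le_total t tb with h1 | h1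
    · exact c2 t ⟨h.1, h1⟩
    · exact (c1 t ⟨h1, h.2⟩).ge
  have c3 : ∀ t ∈ Set.Ioc (0:ℝ) T,
      (la + lb * beta) / 2 < la * Fa t + lb * Fb t - mua * t := by
    intro t h
    have := mul_lt_mul_of_pos_right hmu h.1
    linarith [c2' t h]
  refine ⟨b0, b1, t0, t1, ?_, c0, c1, c2, c3, ?_, ?_⟩
  · have := hF2 T ⟨hT.le, le_rfl⟩ t1.le
    have h2 : lb * Fb T = lb * 1 := by linarith
    exact mul_left_cancel₀ hlb.ne' h2
  · rintro t ⟨ht1, hs⟩ s hs1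
    have e : t = 0 := by
      by_contra hne
      have hp : 0 < t := lt_of_le_of_ne ht1.1 (Ne.symm hne)
      have key : ∀ u, 0 ≤ u → Fext T Fa u = 1 := by
        intro u hu
        unfold Fext
        rw [if_neg (not_lt.mpr hu)]
        split_ifs with h
        · exact hFa u ⟨hu, h⟩
        · exact hFa T ⟨hT.le, le_rfl⟩
      have := hs t hp
      rw [key _ (by linarith), key _ (by linarith)] at this
      exact lt_irrefl _ this
    subst e
    unfold cost
    rw [if_pos rfl, c0]
    split_ifs with h
    · exact le_rfl
    · exact (c3 s ⟨lt_of_le_of_ne hs1.1 (Ne.symm h), hs1.2⟩).le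
  · rintro t ⟨ht1, hs⟩ s hs1
    have e : cost la lb mub Fa Fb t = (la + lb * beta) / 2 := by
      unfold cost
      split_ifs with h
      · exact c0
      · rcases le_or_gt tb t with h1 | h1
        · exact c1 t ⟨h1, ht1.2⟩
        · exfalso
          have hp : 0 < t := lt_of_le_of_ne ht1.1 (Ne.symm h)
          have key : ∀ u, 0 ≤ u → u ≤ tb → Fext T Fb u = beta := by
            intro u hu hu'
            unfold Fext
            rw [if_neg (not_lt.mpr hu), if_pos (hu'.trans t1.le)]
            exact hFb1 u ⟨hu, hu'.trans t1.le⟩ hu'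
          have m1 := min_le_left t (tb - t)
          have m2 := min_le_right t (tb - t)
          have m3 : 0 < min t (tb - t) := lt_min hp (by linarith)
          have := hs _ m3
          rw [key _ (by linarith) (by linarith), key _ (by linarith) (by linarith)] at this
          exact lt_irrefl _ this
    rw [e]
    unfold cost
    split_ifs with h
    · exact c0.ge
    · exact c2' s ⟨lt_of_le_of_ne hs1.1 (Ne.symm h), hs1.2⟩
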